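/- arXiv:2502.05008 — 6 statements merged into one kernel-verified Lean document; each statement's English description precedes it below -/
import Mathlib

section
/- Let F_k ∈ ℝ^{n×n}, H_k ∈ ℝ^{p×n} (k ∈ ℕ) be a linear time-varying system whose unobservable subspace at each time k equals the column space (range) of a matrix N_k ∈ ℝ^{n×r}, partitioned as N_k = [N_{1,k}; N_{2,k}] with N_{1,k} ∈ ℝ^{r×r} invertible and N_{2,k} ∈ ℝ^{(n−r)×r}. Define the block matrix M_k := [[N_{1,k}, 0_{r×(n−r)}], [N_{2,k}, I_{n−r}]] and the transformation T_k := M_k^{-1}. Then M_k is invertible, and the transformed system with Jacobians F̄_k := T_{k+1}·F_k·T_k^{-1}, H̄_k := H_k·T_k^{-1} has unobservable subspace ⋂_{ℓ≥0} ker(H̄_{k+ℓ}·F̄_{k+ℓ−1}⋯F̄_k) equal, at every time k, to the column space of the constant matrix [I_r; 0_{(n−r)×r}]; in particular it is state-independent (the same constant subspace basis at all times). -/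
open Matrix

/-- Ordered product `F_{k+ℓ-1} ⋯ F_k` of the state-propagation matrices,
with the empty product (`ℓ = 0`) equal to the identity. -/
def obsProd {ι : Type*} [Fintype ι] [DecidableEq ι]
    (F : ℕ → Matrix ι ι ℝ) : ℕ → ℕ → Matrix ι ι ℝ
  | _, 0 => 1
  | k, ℓ + 1 => F (k + ℓ) * obsProd F k ℓ

/-- The unobservable subspace at time `k`:
`N_k = ⋂_{ℓ ≥ 0} ker (H_{k+ℓ} · F_{k+ℓ-1} ⋯ F_k)`. -/
def unobsSubspace {ι κ : Type*} [Fintype ι] [DecidableEq ι] [Fintype κ]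
    (F : ℕ → Matrix ι ι ℝ) (H : ℕ → Matrix κ ι ℝ) (k : ℕ) : Submodule ℝ (ι → ℝ) :=
  ⨅ ℓ : ℕ, LinearMap.ker (Matrix.mulVecLin (H (k + ℓ) * obsProd F k ℓ))

/-- A change of coordinates conjugates the ordered products of the state-propagation matrices. -/
theorem obsProd_conj {ι : Type*} [Fintype ι] [DecidableEq ι] (F T : ℕ → Matrix ι ι ℝ)
    (hT : ∀ k, IsUnit (T k)) (k ℓ : ℕ) :
    obsProd (fun j => T (j + 1) * F j * (T j)⁻¹) k ℓ = T (k + ℓ) * obsProd F k ℓ * (T k)⁻¹ := by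
  have hdet (j : ℕ) : IsUnit (T j).det := (isUnit_iff_isUnit_det _).mp (hT j)
  induction ℓ with
  | zero => simp [obsProd, mul_nonsing_inv _ (hdet k)]
  | succ ℓ ih =>
    rw [obsProd, ih]
    simp only [obsProd, Matrix.mul_assoc, nonsing_inv_mul_cancel_left _ _ (hdet (k + ℓ)),
      Nat.add_assoc]

/-- The unobservable subspace of the system in the coordinates `T k *ᵥ x` is the preimage of the
original one under `(T k)⁻¹`. -/
theorem unobsSubspace_conj {ι κ : Type*} [Fintype ι] [DecidableEq ι] [Fintype κ]
    (F T : ℕ → Matrix ι ι ℝ) (H : ℕ → Matrix κ ι ℝ) (hT : ∀ k, IsUnit (T k)) (k : ℕ) :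
    unobsSubspace (fun j => T (j + 1) * F j * (T j)⁻¹) (fun j => H j * (T j)⁻¹) k
      = (unobsSubspace F H k).comap (mulVecLin (T k)⁻¹) := by
  have hdet (j : ℕ) : IsUnit (T j).det := (isUnit_iff_isUnit_det _).mp (hT j)
  simp only [unobsSubspace, Submodule.comap_iInf, ← LinearMap.ker_comp, ← mulVecLin_mul,
    obsProd_conj F T hT]
  simp only [Matrix.mul_assoc, nonsing_inv_mul_cancel_left _ _ (hdet _)]

/-- Preimages under an invertible matrix undo left multiplication on column spaces. -/
theorem comap_mulVecLin_range_mul {ι κ : Type*} [Fintype ι] [DecidableEq ι] [Fintype κ]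
    (M : Matrix ι ι ℝ) (hM : IsUnit M) (E : Matrix ι κ ℝ) :
    (LinearMap.range (mulVecLin (M * E))).comap (mulVecLin M) = LinearMap.range (mulVecLin E) := by
  rw [mulVecLin_mul, LinearMap.range_comp,
    Submodule.comap_map_eq_of_injective (mulVec_injective_iff_isUnit.mpr hM)]

/-- Transformation design approach 1: if the unobservable subspace of the system at every
time `k` is the column space of `N_k = [N_{1,k}; N_{2,k}]` with `N_{1,k}` invertible, then
`M_k := [[N_{1,k}, 0], [N_{2,k}, I]]` is invertible, and with `T_k := M_k⁻¹` the
transformed system `F̄_j := T_{j+1} F_j T_j⁻¹`, `H̄_j := H_j T_j⁻¹` has unobservable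
subspace equal, at every time, to the column space of the constant matrix `[I_r; 0]`. -/
theorem transformed_unobs_state_independent {r s q : ℕ}
    (F : ℕ → Matrix (Fin r ⊕ Fin s) (Fin r ⊕ Fin s) ℝ)
    (H : ℕ → Matrix (Fin q) (Fin r ⊕ Fin s) ℝ)
    (N1 : ℕ → Matrix (Fin r) (Fin r) ℝ) (N2 : ℕ → Matrix (Fin s) (Fin r) ℝ)
    (hN1 : ∀ k, IsUnit (N1 k))
    (hN : ∀ k, unobsSubspace F H k
      = LinearMap.range (Matrix.mulVecLin (Matrix.fromRows (N1 k) (N2 k))))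
    (M T : ℕ → Matrix (Fin r ⊕ Fin s) (Fin r ⊕ Fin s) ℝ)
    (hM : ∀ k, M k = Matrix.fromBlocks (N1 k) 0 (N2 k) 1)
    (hT : ∀ k, T k = (M k)⁻¹) :
    (∀ k, IsUnit (M k)) ∧
      ∀ k, unobsSubspace (fun j => T (j + 1) * F j * (T j)⁻¹) (fun j => H j * (T j)⁻¹) k
        = LinearMap.range (Matrix.mulVecLin
            (Matrix.fromRows (1 : Matrix (Fin r) (Fin r) ℝ)
              (0 : Matrix (Fin s) (Fin r) ℝ))) := by
  have hM_unit (k : ℕ) : IsUnit (M k) := by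
    rw [hM, isUnit_iff_isUnit_det, det_fromBlocks_zero₁₂, det_one, mul_one]
    exact (isUnit_iff_isUnit_det _).mp (hN1 k)
  have hT_unit (k : ℕ) : IsUnit (T k) := by
    rw [hT]
    exact isUnit_nonsing_inv_iff.mpr (hM_unit k)
  refine ⟨hM_unit, fun k => ?_⟩
  have hcols : fromRows (N1 k) (N2 k)
      = M k * (fromRows 1 0 : Matrix (Fin r ⊕ Fin s) (Fin r) ℝ) := by
    simp [hM, fromBlocks_mul_fromRows]
  rw [unobsSubspace_conj F T H hT_unit, hN, hcols, hT,
    nonsing_inv_nonsing_inv _ ((isUnit_iff_isUnit_det _).mp (hM_unit k)),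
    comap_mulVecLin_range_mul _ (hM_unit k)]
end

section
/- Let P ∈ ℝ^{n×n}, H ∈ ℝ^{p×n}, D ∈ ℝ^{p×q}, R ∈ ℝ^{q×q}, let T ∈ ℝ^{n×n} be invertible, set P̄ := T·P·Tᵀ, H̄ := H·T^{-1}, assume Σ := H·P·Hᵀ + D·R·Dᵀ is invertible, and set K̂ := P·Hᵀ·Σ^{-1}, K̄ := P̄·H̄ᵀ·(H̄·P̄·H̄ᵀ + D·R·Dᵀ)^{-1}. Then (i) the covariance updates agree up to congruence: (I − K̄·H̄)·P̄ = T·((I − K̂·H)·P)·Tᵀ; and (ii) for any invertible T′ ∈ ℝ^{n×n}, the corrected covariance P⁺ := ΔT·((I − K̂·H)·P)·ΔTᵀ with correction factor ΔT := T′^{-1}·T satisfies T′·P⁺·T′ᵀ = (I − K̄·H̄)·P̄. (This verifies that the covariance-correction step of T-EKF 2 reproduces the T-EKF 1 update expressed in the original coordinates.) -/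
open Matrix

/-- Equivalence of the covariance update / correction steps of T-EKF 1 and T-EKF 2: with
`P̄ := T P Tᵀ`, `H̄ := H T⁻¹`, invertible `Σ := H P Hᵀ + D R Dᵀ`, `K̂ := P Hᵀ Σ⁻¹` and
`K̄ := P̄ H̄ᵀ (H̄ P̄ H̄ᵀ + D R Dᵀ)⁻¹`:
(i) `(I − K̄ H̄) P̄ = T ((I − K̂ H) P) Tᵀ`; and
(ii) for any invertible `T′`, the corrected covariance
`P⁺ := ΔT ((I − K̂ H) P) ΔTᵀ` with `ΔT := T′⁻¹ T` satisfies `T′ P⁺ T′ᵀ = (I − K̄ H̄) P̄`. -/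
theorem covariance_update_equivalence {n p q : ℕ}
    (P T : Matrix (Fin n) (Fin n) ℝ) (H : Matrix (Fin p) (Fin n) ℝ)
    (D : Matrix (Fin p) (Fin q) ℝ) (R : Matrix (Fin q) (Fin q) ℝ)
    (hT : IsUnit T) (hSig : IsUnit (H * P * Hᵀ + D * R * Dᵀ)) :
    ((1 : Matrix (Fin n) (Fin n) ℝ)
          - ((T * P * Tᵀ) * (H * T⁻¹)ᵀ
              * ((H * T⁻¹) * (T * P * Tᵀ) * (H * T⁻¹)ᵀ + D * R * Dᵀ)⁻¹) * (H * T⁻¹))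
        * (T * P * Tᵀ)
      = T * (((1 : Matrix (Fin n) (Fin n) ℝ)
          - (P * Hᵀ * (H * P * Hᵀ + D * R * Dᵀ)⁻¹) * H) * P) * Tᵀ ∧
    ∀ T' : Matrix (Fin n) (Fin n) ℝ, IsUnit T' →
      T' * ((T'⁻¹ * T) * (((1 : Matrix (Fin n) (Fin n) ℝ)
            - (P * Hᵀ * (H * P * Hᵀ + D * R * Dᵀ)⁻¹) * H) * P) * (T'⁻¹ * T)ᵀ) * T'ᵀ
        = ((1 : Matrix (Fin n) (Fin n) ℝ)
            - ((T * P * Tᵀ) * (H * T⁻¹)ᵀ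
                * ((H * T⁻¹) * (T * P * Tᵀ) * (H * T⁻¹)ᵀ + D * R * Dᵀ)⁻¹) * (H * T⁻¹))
          * (T * P * Tᵀ) := by
  have hH : H * T⁻¹ * T = H := nonsing_inv_mul_cancel_right T H ((isUnit_iff_isUnit_det T).mp hT)
  have hHt : Tᵀ * (H * T⁻¹)ᵀ = Hᵀ := by rw [← transpose_mul, hH]
  have hPH : (T * P * Tᵀ) * (H * T⁻¹)ᵀ = T * (P * Hᵀ) := by
    rw [Matrix.mul_assoc, hHt, Matrix.mul_assoc]
  have hHP : (H * T⁻¹) * (T * P * Tᵀ) = H * P * Tᵀ := by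
    rw [Matrix.mul_assoc T, ← Matrix.mul_assoc (H * T⁻¹), hH, Matrix.mul_assoc]
  have hInnov : (H * T⁻¹) * (T * P * Tᵀ) * (H * T⁻¹)ᵀ = H * P * Hᵀ := by
    rw [hHP, Matrix.mul_assoc, hHt]
  have hUpdate : ((1 : Matrix (Fin n) (Fin n) ℝ)
          - ((T * P * Tᵀ) * (H * T⁻¹)ᵀ
              * ((H * T⁻¹) * (T * P * Tᵀ) * (H * T⁻¹)ᵀ + D * R * Dᵀ)⁻¹) * (H * T⁻¹))
        * (T * P * Tᵀ)
      = T * (((1 : Matrix (Fin n) (Fin n) ℝ)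
          - (P * Hᵀ * (H * P * Hᵀ + D * R * Dᵀ)⁻¹) * H) * P) * Tᵀ := by
    rw [hInnov, hPH, Matrix.sub_mul, Matrix.mul_assoc _ (H * T⁻¹), hHP]
    simp only [Matrix.sub_mul, Matrix.mul_sub, Matrix.one_mul, Matrix.mul_assoc]
  refine ⟨hUpdate, fun T' hT' => ?_⟩
  have hCorr : T' * (T'⁻¹ * T) = T :=
    mul_nonsing_inv_cancel_left T' T ((isUnit_iff_isUnit_det T').mp hT')
  have hCorrT : (T'⁻¹ * T)ᵀ * T'ᵀ = Tᵀ := by rw [← transpose_mul, hCorr]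
  rw [hUpdate, Matrix.mul_assoc T', Matrix.mul_assoc (T'⁻¹ * T * _), hCorrT,
    Matrix.mul_assoc (T'⁻¹ * T), ← Matrix.mul_assoc T', hCorr, ← Matrix.mul_assoc T]
end

section
/- Let J := !![0, −1; 1, 0] and R(ψ) := !![cos ψ, −sin ψ; sin ψ, cos ψ]. Define the relative-position measurement map h : ℝ² × ℝ × ℝ² → ℝ² of 2D cooperative localization by h(p_i, ψ_i, p_j) = R(ψ_i)ᵀ·(p_j − p_i). Then h is differentiable, and at every point (p_i, ψ_i, p_j) its Fréchet derivative annihilates all global translation–rotation directions: for every t ∈ ℝ² and s ∈ ℝ, Dh(p_i, ψ_i, p_j)[(t + s·J·p_i, s, t + s·J·p_j)] = 0. (That is, the unobservable directions of the cooperative-localization system lie in the kernel of the linearized measurement Jacobian at every linearization point.) -/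
open Matrix

/-- The 2×2 skew matrix `J = [[0, -1], [1, 0]]`. -/
def Jmat : Matrix (Fin 2) (Fin 2) ℝ := !![0, -1; 1, 0]

/-- The 2D rotation matrix `R(ψ)`. -/
noncomputable def Rot (ψ : ℝ) : Matrix (Fin 2) (Fin 2) ℝ :=
  !![Real.cos ψ, -Real.sin ψ; Real.sin ψ, Real.cos ψ]

/-- The relative-position measurement of 2D cooperative localization:
`h(p_i, ψ_i, p_j) = R(ψ_i)ᵀ (p_j − p_i)`. -/
noncomputable def hCL : (Fin 2 → ℝ) × ℝ × (Fin 2 → ℝ) → (Fin 2 → ℝ) :=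
  fun z => (Rot z.2.1)ᵀ.mulVec (z.2.2 - z.1)

theorem hCL_eq (z : (Fin 2 → ℝ) × ℝ × (Fin 2 → ℝ)) :
    hCL z = ![Real.cos z.2.1 * (z.2.2 0 - z.1 0) + Real.sin z.2.1 * (z.2.2 1 - z.1 1),
      -Real.sin z.2.1 * (z.2.2 0 - z.1 0) + Real.cos z.2.1 * (z.2.2 1 - z.1 1)] := by
  ext k
  fin_cases k <;> simp [hCL, Rot, Matrix.mulVec, dotProduct, Fin.sum_univ_two]

theorem differentiable_hCL : Differentiable ℝ hCL := by
  rw [funext hCL_eq, differentiable_pi]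
  intro k
  fin_cases k <;> simp <;> fun_prop

/-- The line through `(pi, ψ, pj)` along a translation–rotation direction moves the relative
position with velocity `s • J (pj - pi)`, which the rotation by `-ψ` compensates. -/
theorem hasLineDerivAt_hCL_translation_rotation (pi pj t : Fin 2 → ℝ) (ψ s : ℝ) :
    HasLineDerivAt ℝ hCL 0 (pi, ψ, pj)
      (t + s • Jmat.mulVec pi, s, t + s • Jmat.mulVec pj) := by
  have hlin (a b : ℝ) : HasDerivAt (fun τ : ℝ => a + τ * b) b 0 := by
    simpa using ((hasDerivAt_id (0 : ℝ)).mul_const b).const_add a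
  have hψ := hlin ψ s
  have hpos (k : Fin 2) :=
    (hlin (pj k) (t k + s * Jmat.mulVec pj k)).sub (hlin (pi k) (t k + s * Jmat.mulVec pi k))
  rw [HasLineDerivAt, funext fun τ : ℝ => hCL_eq _, hasDerivAt_pi]
  intro k
  fin_cases k
  · refine ((hψ.cos.mul (hpos 0)).add (hψ.sin.mul (hpos 1))).congr_deriv ?_
    simp [Jmat, Matrix.mulVec, dotProduct, Fin.sum_univ_two]
    ring
  · refine ((hψ.sin.neg.mul (hpos 0)).add (hψ.cos.mul (hpos 1))).congr_deriv ?_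
    simp [Jmat, Matrix.mulVec, dotProduct, Fin.sum_univ_two]
    ring

/-- `h` is differentiable and its Fréchet derivative annihilates all global
translation–rotation directions `(t + s·J·p_i, s, t + s·J·p_j)` at every point. -/
theorem cl_unobservable_directions_in_kernel :
    Differentiable ℝ hCL ∧
      ∀ (pi pj t : Fin 2 → ℝ) (ψ s : ℝ),
        fderiv ℝ hCL (pi, ψ, pj)
          (t + s • Jmat.mulVec pi, s, t + s • Jmat.mulVec pj) = 0 := by
  refine ⟨differentiable_hCL, fun pi pj t ψ s => ?_⟩
  rw [← (differentiable_hCL _).lineDeriv_eq_fderiv]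
  exact (hasLineDerivAt_hCL_translation_rotation pi pj t ψ s).lineDeriv
end

section
/- Let J := !![0, −1; 1, 0]. Fix m ≥ 1 and robot positions p, q : Fin m → ℝ². Let N(p) ∈ ℝ^{3m×3} be the matrix obtained by vertically stacking the m blocks [[I₂, J·p_i], [0_{1×2}, 1]], and let F(p,q) ∈ ℝ^{3m×3m} be the block-diagonal matrix with diagonal blocks [[I₂, J·(q_i − p_i)], [0_{1×2}, 1]]. Then F(p,q)·N(p) = N(q). (The propagation Jacobian of the m-robot cooperative localization system maps the global translation–rotation unobservable basis at positions p exactly onto the basis at positions q.) -/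
open Matrix

/-- The 3×3 block matrix `[[I₂, J·w], [0, 1]]`. -/
def Ablk (w : Fin 2 → ℝ) : Matrix (Fin 3) (Fin 3) ℝ :=
  !![1, 0, Jmat.mulVec w 0;
     0, 1, Jmat.mulVec w 1;
     0, 0, 1]

/-- The 3m×3 matrix `N(p)` obtained by vertically stacking the `m` blocks
`[[I₂, J·p_i], [0, 1]]`. -/
def Nstack {m : ℕ} (p : Fin m → Fin 2 → ℝ) : Matrix (Fin 3 × Fin m) (Fin 3) ℝ :=
  Matrix.of fun ri c => Ablk (p ri.2) ri.1 c

/-- The blocks `[[I₂, J·w], [0, 1]]` multiply by adding their parameters. -/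
theorem Ablk_mul_Ablk (v w : Fin 2 → ℝ) : Ablk v * Ablk w = Ablk (v + w) := by
  ext i j
  fin_cases i <;> fin_cases j <;>
    simp [Ablk, Matrix.mul_apply, Fin.sum_univ_three, Matrix.mulVec_add, add_comm]

/-- A block-diagonal matrix acts on a stacked matrix block by block. -/
theorem blockDiagonal_mul_Nstack_apply {m : ℕ} (M : Fin m → Matrix (Fin 3) (Fin 3) ℝ)
    (p : Fin m → Fin 2 → ℝ) (r : Fin 3) (i : Fin m) (c : Fin 3) :
    (Matrix.blockDiagonal M * Nstack p) (r, i) c = (M i * Ablk (p i)) r c := by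
  simp [Matrix.mul_apply, Fintype.sum_prod_type, Matrix.blockDiagonal_apply, Nstack]

/-- The propagation Jacobian of the `m`-robot cooperative localization system, i.e. the
block-diagonal matrix with blocks `[[I₂, J·(q_i − p_i)], [0, 1]]`, maps the global
translation–rotation unobservable basis at positions `p` onto the basis at positions `q`:
`F(p,q) · N(p) = N(q)`. -/
theorem cl_unobservable_basis_propagation {m : ℕ} (hm : 1 ≤ m)
    (p q : Fin m → Fin 2 → ℝ) :
    Matrix.blockDiagonal (fun i => Ablk (q i - p i)) * Nstack p = Nstack q := by
  ext ⟨r, i⟩ c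
  rw [blockDiagonal_mul_Nstack_apply, Ablk_mul_Ablk, sub_add_cancel]
  rfl
end

section
/- Let J := !![0, −1; 1, 0] and fix a landmark position p_s = (x_s, y_s) ∈ ℝ². Define the bearing measurement h : ℝ² × ℝ → ℝ by h((x, y), ψ) = arctan((y_s − y)/(x_s − x)) − ψ. Then at every point (p, ψ) with p = (x, y) and x ≠ x_s, h is differentiable and its derivative vanishes in the unobservable direction: Dh(p, ψ)[(J·(p − p_s), 1)] = 0. -/
open Matrix

/-- The bearing-measurement map of the target-tracking system for a landmark at
`(x_s, y_s)`: `h((x, y), ψ) = arctan((y_s − y)/(x_s − x)) − ψ`. -/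
noncomputable def hBearing (xs ys : ℝ) : (Fin 2 → ℝ) × ℝ → ℝ :=
  fun z => Real.arctan ((ys - z.1 1) / (xs - z.1 0)) - z.2

/-- The Fréchet derivative of the bearing measurement away from the line `x = x_s`. -/
theorem hasFDerivAt_hBearing (xs ys : ℝ) (z : (Fin 2 → ℝ) × ℝ) (hz : z.1 0 ≠ xs) :
    HasFDerivAt (hBearing xs ys)
      (((xs - z.1 0) ^ 2 + (ys - z.1 1) ^ 2)⁻¹ •
          ((ys - z.1 1) • (ContinuousLinearMap.proj 0).comp (ContinuousLinearMap.fst ℝ _ ℝ) -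
            (xs - z.1 0) • (ContinuousLinearMap.proj 1).comp (ContinuousLinearMap.fst ℝ _ ℝ)) -
        ContinuousLinearMap.snd ℝ (Fin 2 → ℝ) ℝ) z := by
  have hu : xs - z.1 0 ≠ 0 := sub_ne_zero.mpr hz.symm
  have coord (i : Fin 2) : HasFDerivAt (fun w : (Fin 2 → ℝ) × ℝ => w.1 i)
      ((ContinuousLinearMap.proj (R := ℝ) (φ := fun _ : Fin 2 => ℝ) i).comp
        (ContinuousLinearMap.fst ℝ _ ℝ)) z :=
    ((ContinuousLinearMap.proj (R := ℝ) (φ := fun _ : Fin 2 => ℝ) i).comp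
      (ContinuousLinearMap.fst ℝ _ ℝ)).hasFDerivAt
  have h := ((((coord 1).const_sub ys).mul
    ((hasDerivAt_inv hu).comp_hasFDerivAt z ((coord 0).const_sub xs))).arctan).sub
    (hasFDerivAt_snd (𝕜 := ℝ) (p := z))
  refine h.congr_fderiv ?_
  have hsum : (xs - z.1 0) ^ 2 + (ys - z.1 1) ^ 2 ≠ 0 := by positivity
  refine ContinuousLinearMap.ext fun v => ?_
  simp
  field_simp
  ring

/-- At every point `(p, ψ)` with `x ≠ x_s`, the bearing measurement is differentiable and
its derivative vanishes in the unobservable direction `(J·(p − p_s), 1)`. -/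
theorem bearing_derivative_vanishes_unobservable (xs ys : ℝ)
    (p : Fin 2 → ℝ) (ψ : ℝ) (hx : p 0 ≠ xs) :
    DifferentiableAt ℝ (hBearing xs ys) (p, ψ) ∧
      fderiv ℝ (hBearing xs ys) (p, ψ) (Jmat.mulVec (p - ![xs, ys]), 1) = 0 := by
  have h := hasFDerivAt_hBearing xs ys (p, ψ) hx
  refine ⟨h.differentiableAt, ?_⟩
  have hu : xs - p 0 ≠ 0 := sub_ne_zero.mpr hx.symm
  have hsum : (xs - p 0) ^ 2 + (ys - p 1) ^ 2 ≠ 0 := by positivity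
  rw [h.fderiv]
  simp [Jmat, vecHead, vecTail]
  field_simp
  ring
end

section
/- For a ∈ ℝ³ let [a]_× denote the 3×3 skew-symmetric matrix with [a]_×·w = a × w for all w ∈ ℝ³. Fix m ≥ 0 and vectors g, p, v ∈ ℝ³ and features f : Fin m → ℝ³. Let N ∈ ℝ^{(15+3m)×4} be the block matrix with block rows [0_{3×3}, g], [I₃, −[p]_×·g], [0_{3×3}, −[v]_×·g], [0_{6×3}, 0_{6×1}], and [I₃, −[f_i]_×·g] for i = 1,…,m; let N̄ ∈ ℝ^{(15+3m)×4} be the block matrix with block rows [0_{3×3}, g], [I₃, 0], [0_{3×3}, 0], [0_{6×3}, 0], and [I₃, 0] for i = 1,…,m. Let M ∈ ℝ^{(15+3m)×(15+3m)} be the block matrix whose first block column (of width 3) is [I₃; −[p]_×; −[v]_×; 0_{6×3}; −[f_1]_×; …; −[f_m]_×] and which agrees with the identity matrix in all remaining columns. Then M is invertible and M·N̄ = N; equivalently, the visual-inertial navigation transformation T := M^{-1} maps the state-dependent unobservable basis N to the constant matrix N̄ = T·N. -/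
open Matrix

/-- The shared left 3×3 blocks of the unobservable bases `N` and `N̄` of the visual-inertial
navigation system: `0, I₃, 0, 0, 0` for the IMU blocks and `I₃` for each feature block. -/
def vinsLeftBlk (m : ℕ) : Fin 5 ⊕ Fin m → Matrix (Fin 3) (Fin 3) ℝ :=
  Sum.elim ![0, 1, 0, 0, 0] fun _ => 1

/-- The state-dependent unobservable basis `N` of the visual-inertial navigation system, with
block rows `[0, g]`, `[I₃, −[p]×·g]`, `[0, −[v]×·g]`, `[0_{6×3}, 0]`, and `[I₃, −[f_i]×·g]`. -/
def vinsN (m : ℕ) (skew : (Fin 3 → ℝ) → Matrix (Fin 3) (Fin 3) ℝ)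
    (g p v : Fin 3 → ℝ) (f : Fin m → Fin 3 → ℝ) :
    Matrix ((Fin 5 ⊕ Fin m) × Fin 3) (Fin 3 ⊕ Fin 1) ℝ :=
  Matrix.of fun br c =>
    Sum.elim (fun j => vinsLeftBlk m br.1 br.2 j)
      (fun _ =>
        Sum.elim ![g, -(skew p).mulVec g, -(skew v).mulVec g, 0, 0]
          (fun i => -(skew (f i)).mulVec g) br.1 br.2) c

/-- The constant unobservable basis `N̄`, with block rows `[0, g]`, `[I₃, 0]`, `[0, 0]`,
`[0_{6×3}, 0]`, and `[I₃, 0]`. -/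
def vinsNbar (m : ℕ) (g : Fin 3 → ℝ) :
    Matrix ((Fin 5 ⊕ Fin m) × Fin 3) (Fin 3 ⊕ Fin 1) ℝ :=
  Matrix.of fun br c =>
    Sum.elim (fun j => vinsLeftBlk m br.1 br.2 j)
      (fun _ => Sum.elim ![g, 0, 0, 0, 0] (fun _ => (0 : Fin 3 → ℝ)) br.1 br.2) c

/-- The first block column (of width 3) of the transformation matrix `M`:
`[I₃; −[p]×; −[v]×; 0_{6×3}; −[f_1]×; …; −[f_m]×]`. -/
def vinsColBlk (m : ℕ) (skew : (Fin 3 → ℝ) → Matrix (Fin 3) (Fin 3) ℝ)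
    (p v : Fin 3 → ℝ) (f : Fin m → Fin 3 → ℝ) :
    Fin 5 ⊕ Fin m → Matrix (Fin 3) (Fin 3) ℝ :=
  Sum.elim ![1, -skew p, -skew v, 0, 0] fun i => -skew (f i)

/-- The (15+3m)×(15+3m) matrix `M` whose first block column (of width 3) is
`[I₃; −[p]×; −[v]×; 0_{6×3}; −[f_1]×; …; −[f_m]×]` and which agrees with the identity matrix
in all remaining columns. -/
def vinsM (m : ℕ) (skew : (Fin 3 → ℝ) → Matrix (Fin 3) (Fin 3) ℝ)
    (p v : Fin 3 → ℝ) (f : Fin m → Fin 3 → ℝ) :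
    Matrix ((Fin 5 ⊕ Fin m) × Fin 3) ((Fin 5 ⊕ Fin m) × Fin 3) ℝ :=
  Matrix.of fun br bc =>
    if bc.1 = Sum.inl (0 : Fin 5) then vinsColBlk m skew p v f br.1 br.2 bc.2
    else if br = bc then 1 else 0

theorem vinsM_mul_apply {n : Type*} (m : ℕ)
    (skew : (Fin 3 → ℝ) → Matrix (Fin 3) (Fin 3) ℝ)
    (p v : Fin 3 → ℝ) (f : Fin m → Fin 3 → ℝ)
    (X : Matrix ((Fin 5 ⊕ Fin m) × Fin 3) n ℝ) (b : Fin 5 ⊕ Fin m) (i : Fin 3) (c : n) :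
    (vinsM m skew p v f * X) (b, i) c =
      (if b = Sum.inl 0 then 0 else X (b, i) c) +
        ∑ k, vinsColBlk m skew p v f b i k * X (Sum.inl 0, k) c := by
  have key : ∀ x : (Fin 5 ⊕ Fin m) × Fin 3, vinsM m skew p v f (b, i) x * X x c =
      (if (b, i) = x then (if b = Sum.inl 0 then 0 else X (b, i) c) else 0) +
        (if x.1 = Sum.inl 0 then
          vinsColBlk m skew p v f b i x.2 * X (Sum.inl 0, x.2) c else 0) := by
    rintro ⟨b', k⟩
    by_cases hb : b' = Sum.inl 0
    · subst hb
      simp only [vinsM, of_apply, if_true]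
      split_ifs with h h' <;> simp_all
    · simp only [vinsM, of_apply, hb, if_false]
      split_ifs with h h' <;> simp_all
  rw [mul_apply, Finset.sum_congr rfl fun x _ => key x, Finset.sum_add_distrib]
  congr 1
  · simp
  · rw [Fintype.sum_prod_type, Finset.sum_eq_single (Sum.inl 0)] <;> simp +contextual

theorem vinsColBlk_neg (m : ℕ) (skew : (Fin 3 → ℝ) → Matrix (Fin 3) (Fin 3) ℝ)
    (p v : Fin 3 → ℝ) (f : Fin m → Fin 3 → ℝ) {b : Fin 5 ⊕ Fin m} (hb : b ≠ Sum.inl 0) :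
    vinsColBlk m (-skew) p v f b = -vinsColBlk m skew p v f b := by
  rcases b with b | b
  · fin_cases b <;> simp_all [vinsColBlk]
  · simp [vinsColBlk]

theorem vinsColBlk_mulVec (m : ℕ) (skew : (Fin 3 → ℝ) → Matrix (Fin 3) (Fin 3) ℝ)
    (g p v : Fin 3 → ℝ) (f : Fin m → Fin 3 → ℝ) (b : Fin 5 ⊕ Fin m) :
    vinsColBlk m skew p v f b *ᵥ g =
      Sum.elim ![g, -(skew p *ᵥ g), -(skew v *ᵥ g), 0, 0] (fun i => -(skew (f i) *ᵥ g)) b := by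
  rcases b with b | b
  · fin_cases b <;> simp [vinsColBlk, neg_mulVec]
  · simp [vinsColBlk, neg_mulVec]

theorem vinsM_mul_vinsM_neg (m : ℕ) (skew : (Fin 3 → ℝ) → Matrix (Fin 3) (Fin 3) ℝ)
    (p v : Fin 3 → ℝ) (f : Fin m → Fin 3 → ℝ) :
    vinsM m skew p v f * vinsM m (-skew) p v f = 1 := by
  have first_row : ∀ k c, vinsM m (-skew) p v f (Sum.inl 0, k) c =
      if (Sum.inl 0, k) = c then 1 else 0 := by
    rintro k ⟨b', j⟩
    by_cases hb : b' = Sum.inl 0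
    · subst hb
      simp [vinsM, vinsColBlk, one_apply]
    · simp [vinsM, hb]
  ext ⟨b, i⟩ ⟨b', j⟩
  rw [vinsM_mul_apply]
  simp only [first_row, one_apply]
  by_cases hb' : b' = Sum.inl 0
  · subst hb'
    by_cases hb : b = Sum.inl 0
    · subst hb
      simp [vinsColBlk, one_apply]
    · simp [vinsM, hb, vinsColBlk_neg]
  · by_cases hb : b = Sum.inl 0
    · subst hb
      simp [Ne.symm hb']
    · simp [vinsM, hb, hb', Ne.symm hb']

theorem vinsM_mul_vinsNbar (m : ℕ) (skew : (Fin 3 → ℝ) → Matrix (Fin 3) (Fin 3) ℝ)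
    (g p v : Fin 3 → ℝ) (f : Fin m → Fin 3 → ℝ) :
    vinsM m skew p v f * vinsNbar m g = vinsN m skew g p v f := by
  ext ⟨b, i⟩ c
  rw [vinsM_mul_apply]
  rcases c with j | j
  · by_cases hb : b = Sum.inl 0
    · subst hb
      simp [vinsN, vinsNbar, vinsLeftBlk]
    · simp [vinsN, vinsNbar, vinsLeftBlk, hb]
  · have hcol : (if b = Sum.inl 0 then 0 else vinsNbar m g (b, i) (Sum.inr j)) = 0 := by
      rcases b with b | b
      · fin_cases b <;> rfl
      · rfl
    rw [hcol, zero_add]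
    exact congrFun (vinsColBlk_mulVec m skew g p v f b) i

/-- `M` is invertible and `M · N̄ = N`; equivalently, the visual-inertial navigation
transformation `T := M⁻¹` maps the state-dependent unobservable basis `N` onto the constant
matrix `N̄ = T · N`. Here `skew` is the skew-symmetric matrix of the cross product:
`[a]× · w = a × w` for all `w`. -/
theorem vins_transformation_maps_basis (m : ℕ)
    (skew : (Fin 3 → ℝ) → Matrix (Fin 3) (Fin 3) ℝ)
    (hskew : ∀ a w : Fin 3 → ℝ, (skew a).mulVec w = crossProduct a w)
    (g p v : Fin 3 → ℝ) (f : Fin m → Fin 3 → ℝ) :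
    IsUnit (vinsM m skew p v f) ∧
      vinsM m skew p v f * vinsNbar m g = vinsN m skew g p v f ∧
      (vinsM m skew p v f)⁻¹ * vinsN m skew g p v f = vinsNbar m g := by
  have hunit : IsUnit (vinsM m skew p v f) :=
    IsUnit.of_mul_eq_one _ (vinsM_mul_vinsM_neg m skew p v f)
  refine ⟨hunit, vinsM_mul_vinsNbar m skew g p v f, ?_⟩
  rw [← vinsM_mul_vinsNbar,
    nonsing_inv_mul_cancel_left _ _ ((isUnit_iff_isUnit_det _).mp hunit)]
end
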